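/- Let N L : ℕ, set d = 2^L, and let p ∈ MvPolynomial (Fin N) ℝ satisfy totalDegree p ≤ d. Then there exist a bond dimension r : ℕ, cores G : Fin N → Fin (d+1) → Matrix (Fin r) (Fin r) ℝ, and boundary vectors u v : Fin r → ℝ such that for every x : Fin N → ℝ: MvPolynomial.eval x p = u ⬝ᵥ ((∏_{i=0}^{N-1} (∑_{k : Fin (d+1)} (x i) ^ ((k : ℕ)) • G i k)).mulVec v), where the matrix product is taken in the order i = 0, 1, …, N−1. -/

import Mathlib

open Matrix

/-- An ordered product of diagonal matrices is the diagonal matrix of the entrywise products. -/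
theorem Matrix.list_prod_ofFn_diagonal {ι R : Type*} [Fintype ι] [DecidableEq ι] [CommSemiring R]
    {N : ℕ} (f : Fin N → ι → R) :
    (List.ofFn fun i => diagonal (f i)).prod = diagonal fun j => ∏ i, f i j := by
  have h := map_list_prod (diagonalRingHom ι R) (List.ofFn f)
  rw [List.map_ofFn, List.prod_ofFn] at h
  refine h.symm.trans (congrArg diagonal ?_)
  ext j
  simp

/-- Contracting the powers of `a` with the diagonal indicator core of `e` gives the diagonal matrix
with entries `a ^ e j`. -/
theorem Matrix.sum_pow_smul_diagonal_indicator {ι R : Type*} [DecidableEq ι] [CommSemiring R]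
    {d : ℕ} (e : ι → ℕ) (he : ∀ j, e j ≤ d) (a : R) :
    ∑ k : Fin (d + 1), a ^ (k : ℕ) • diagonal (fun j => if e j = (k : ℕ) then (1 : R) else 0) =
      diagonal fun j => a ^ e j := by
  ext i j
  rw [Matrix.sum_apply]
  by_cases hij : i = j
  · subst hij
    rw [Finset.sum_eq_single ⟨e i, Nat.lt_succ_of_le (he i)⟩]
    · simp
    · intro k _ hk
      have : e i ≠ k := fun h => hk (Fin.ext h.symm)
      simp [this]
    · simp
  · simp [hij]

theorem polynomial_network_to_quantum_inspired_tn (N L : ℕ)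
    (p : MvPolynomial (Fin N) ℝ) (hp : p.totalDegree ≤ 2 ^ L) :
    ∃ (r : ℕ) (G : Fin N → Fin (2 ^ L + 1) → Matrix (Fin r) (Fin r) ℝ)
      (u v : Fin r → ℝ),
      ∀ x : Fin N → ℝ,
        MvPolynomial.eval x p =
          u ⬝ᵥ ((List.ofFn (fun i : Fin N =>
            ∑ k : Fin (2 ^ L + 1), (x i) ^ ((k : ℕ)) • G i k)).prod).mulVec v := by
  let m : Fin p.support.card → Fin N →₀ ℕ := fun j => p.support.equivFin.symm j
  have hm (i : Fin N) (j : Fin p.support.card) : m j i ≤ 2 ^ L :=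
    ((MvPolynomial.le_degreeOf_of_mem_support i (p.support.equivFin.symm j).2).trans
      (MvPolynomial.degreeOf_le_totalDegree p i)).trans hp
  refine ⟨p.support.card, fun i k => diagonal fun j => if m j i = (k : ℕ) then 1 else 0,
    fun j => p.coeff (m j), fun _ => 1, fun x => ?_⟩
  simp_rw [fun i => sum_pow_smul_diagonal_indicator (fun j => m j i) (hm i) (x i)]
  rw [list_prod_ofFn_diagonal, MvPolynomial.eval_eq', ← Finset.sum_coe_sort,
    ← Equiv.sum_comp p.support.equivFin.symm]
  simp [dotProduct, mulVec_diagonal, m]
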